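/- arXiv:2401.15502 — 2 statements merged into one kernel-verified Lean document; each statement's English description precedes it below -/
import Mathlib

section
/- Let κ > 0 and let (ω_n) be a sequence in (0, 1/2) with ω_n → 0. For each n let Z_n be a real-valued random variable with the standard normal law N(0, 1) (the null hypothesis H₀ for the z-test). Then the truncated Bayes factor BF_n(Z_n) converges to 0 in probability: for every δ > 0, P(BF_n(Z_n) > δ) → 0 as n → ∞. -/
open MeasureTheory ProbabilityTheory Filter

/-- The confluent hypergeometric series `₁F₁(a; c; x)`. -/
noncomputable def oneF₁ (a c x : ℝ) : ℝ :=
  ∑' k : ℕ, (ascPochhammer ℝ k).eval a / ((ascPochhammer ℝ k).eval c * (k.factorial : ℝ)) * x ^ k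

/-- The marginal likelihood ratio of the z-statistic under the normal-moment prior with
`τ² = κn`. -/
noncomputable def Rz (κ : ℝ) (n : ℕ) (z : ℝ) : ℝ :=
  (1 + κ * n) ^ (-(3:ℝ)/2) * oneF₁ (3/2) (1/2) (κ * n * z^2 / (2 * (1 + κ * n)))

/-- The truncated Bayes factor for the z-test with mixture weight `ω n`. -/
noncomputable def BFz (κ : ℝ) (ω : ℕ → ℝ) (n : ℕ) (z : ℝ) : ℝ :=
  (ω n + (1 - ω n) * Rz κ n z) / ((1 - ω n) + ω n * Rz κ n z)

theorem ascPochhammer_eval_add_one_mul (a : ℝ) (k : ℕ) :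
    (ascPochhammer ℝ k).eval (a + 1) * a = (ascPochhammer ℝ k).eval a * (a + k) := by
  induction k with
  | zero => simp
  | succ k ih =>
    rw [ascPochhammer_succ_eval, ascPochhammer_succ_eval]
    push_cast
    linear_combination (a + 1 + k) * ih

/-- Closed form of the coefficients of `₁F₁(3/2; 1/2; x)`. -/
theorem ascPochhammer_three_halves_div (k : ℕ) :
    (ascPochhammer ℝ k).eval (3/2) / ((ascPochhammer ℝ k).eval (1/2) * (k.factorial : ℝ)) =
      (2 * k + 1) / (k.factorial : ℝ) := by
  have h := ascPochhammer_eval_add_one_mul (1/2) k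
  have hpos : 0 < (ascPochhammer ℝ k).eval (1/2 : ℝ) := ascPochhammer_pos k _ (by norm_num)
  have hf : (0 : ℝ) < k.factorial := by positivity
  rw [show (1/2 + 1 : ℝ) = 3/2 by norm_num] at h
  rw [div_eq_div_iff (by positivity) (by positivity)]
  linear_combination (2 * (k.factorial : ℝ)) * h

theorem oneF₁_three_halves_nonneg {x : ℝ} (hx : 0 ≤ x) : 0 ≤ oneF₁ (3/2) (1/2) x := by
  refine tsum_nonneg fun k => ?_
  rw [ascPochhammer_three_halves_div]
  positivity

theorem oneF₁_three_halves_le {x : ℝ} (hx : 0 ≤ x) :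
    oneF₁ (3/2) (1/2) x ≤ Real.exp (3 * x) := by
  have hexp : HasSum (fun k : ℕ => (3 * x) ^ k / (k.factorial : ℝ)) (Real.exp (3 * x)) := by
    rw [Real.exp_eq_exp_ℝ]
    exact NormedSpace.expSeries_div_hasSum_exp (3 * x)
  have hle : ∀ k : ℕ, (ascPochhammer ℝ k).eval (3/2) /
      ((ascPochhammer ℝ k).eval (1/2) * (k.factorial : ℝ)) * x ^ k ≤
        (3 * x) ^ k / (k.factorial : ℝ) := by
    intro k
    rw [ascPochhammer_three_halves_div, mul_pow, div_mul_eq_mul_div]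
    have h3 : (2 * k + 1 : ℝ) ≤ 3 ^ k := by
      have := one_add_mul_le_pow (show (-2 : ℝ) ≤ 2 by norm_num) k
      norm_num at this
      linarith
    gcongr
  have hnn : ∀ k : ℕ, 0 ≤ (ascPochhammer ℝ k).eval (3/2) /
      ((ascPochhammer ℝ k).eval (1/2) * (k.factorial : ℝ)) * x ^ k := by
    intro k
    rw [ascPochhammer_three_halves_div]
    positivity
  rw [← hexp.tsum_eq]
  exact (hexp.summable.of_nonneg_of_le hnn hle).tsum_le_tsum hle hexp.summable

theorem Rz_nonneg {κ : ℝ} (hκ : 0 < κ) (n : ℕ) (z : ℝ) : 0 ≤ Rz κ n z :=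
  mul_nonneg (by positivity) (oneF₁_three_halves_nonneg (by positivity))

theorem Rz_le {κ : ℝ} (hκ : 0 < κ) (n : ℕ) (z : ℝ) :
    Rz κ n z ≤ (1 + κ * n) ^ (-(3:ℝ)/2) * Real.exp (3 * (z ^ 2 / 2)) := by
  have hx : κ * n * z^2 / (2 * (1 + κ * n)) ≤ z ^ 2 / 2 := by
    rw [div_le_div_iff₀ (by positivity) (by norm_num)]
    nlinarith [sq_nonneg z]
  unfold Rz
  gcongr
  exact (oneF₁_three_halves_le (by positivity)).trans (Real.exp_le_exp.2 (by linarith))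

theorem BFz_le {κ : ℝ} (hκ : 0 < κ) {ω : ℕ → ℝ} {n : ℕ} (hω : ω n ∈ Set.Ioo (0:ℝ) (1/2))
    (z : ℝ) :
    BFz κ ω n z ≤
      2 * (ω n + (1 + κ * n) ^ (-(3:ℝ)/2) * Real.exp (3 * (z ^ 2 / 2))) := by
  obtain ⟨h0, h1⟩ := hω
  have hR := Rz_nonneg hκ n z
  have hωR := mul_nonneg h0.le hR
  refine le_trans ?_ (mul_le_mul_of_nonneg_left (add_le_add_right (Rz_le hκ n z) _) zero_le_two)
  unfold BFz
  rw [div_le_iff₀ (by linarith)]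
  have : 0 ≤ (ω n + Rz κ n z) * (1 - 2 * ω n + 2 * (ω n * Rz κ n z)) :=
    mul_nonneg (by linarith) (by linarith)
  nlinarith

theorem tendsto_one_add_mul_rpow_neg {κ : ℝ} (hκ : 0 < κ) :
    Tendsto (fun n : ℕ => (1 + κ * n) ^ (-(3:ℝ)/2)) atTop (nhds 0) := by
  have h : Tendsto (fun n : ℕ => 1 + κ * (n : ℝ)) atTop atTop :=
    tendsto_atTop_add_const_left _ _ (tendsto_natCast_atTop_atTop.const_mul_atTop hκ)
  rw [neg_div]
  exact (tendsto_rpow_neg_atTop (by norm_num)).comp h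

/-- Under the null hypothesis `H₀` (standard normal z-statistic), with `ω_n → 0`,
the truncated Bayes factor for the z-test converges to `0` in probability. -/
theorem truncatedBF_z_null_consistent (κ : ℝ) (hκ : 0 < κ)
    (ω : ℕ → ℝ) (hω : ∀ n, ω n ∈ Set.Ioo (0:ℝ) (1/2)) (hω0 : Tendsto ω atTop (nhds 0))
    {Ω : Type*} [MeasureSpace Ω] [IsProbabilityMeasure (ℙ : Measure Ω)]
    (Z : ℕ → Ω → ℝ) (hZ : ∀ n, Measure.map (Z n) ℙ = gaussianReal 0 1) :
    ∀ δ : ℝ, 0 < δ →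
      Tendsto (fun n => ℙ {w | BFz κ ω n (Z n w) > δ}) atTop (nhds 0) := by
  intro δ hδ
  set g : ℕ → ℝ → ℝ := fun n z =>
    2 * (ω n + (1 + κ * n) ^ (-(3:ℝ)/2) * Real.exp (3 * (z ^ 2 / 2))) with hg
  have hgm : ∀ n, Measurable (g n) := fun n => by fun_prop
  have hlim : ∀ z, Tendsto (fun n => g n z) atTop (nhds 0) := fun z => by
    simpa using (hω0.add ((tendsto_one_add_mul_rpow_neg hκ).mul_const
      (Real.exp (3 * (z ^ 2 / 2))))).const_mul 2
  have hmeas : TendstoInMeasure (gaussianReal 0 1) g atTop (fun _ => 0) :=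
    tendstoInMeasure_of_tendsto_ae (fun n => (hgm n).aestronglyMeasurable) (ae_of_all _ hlim)
  rw [tendstoInMeasure_iff_norm] at hmeas
  refine tendsto_of_tendsto_of_tendsto_of_le_of_le tendsto_const_nhds (hmeas δ hδ)
    (fun _ => zero_le) fun n => ?_
  have hae : AEMeasurable (Z n) ℙ := by
    refine AEMeasurable.of_map_ne_zero ?_
    rw [hZ n]
    exact IsProbabilityMeasure.ne_zero _
  simp only [← hZ n, sub_zero]
  rw [Measure.map_apply_of_aemeasurable hae
    (measurableSet_le measurable_const (hgm n).norm)]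
  refine measure_mono fun w hw => ?_
  exact (le_of_lt hw).trans ((BFz_le hκ (hω n) (Z n w)).trans (le_abs_self _))
end

section
/- Let κ > 0 and let η ≠ 0 be a real number. For each n let Z_n be a real-valued random variable with the Gaussian law N(η√n, 1). Then for every constant c with 0 < c < η²/2, P( R_n(Z_n) ≥ exp(c n) ) → 1 as n → ∞; equivalently, under the alternative hypothesis the reciprocal marginal likelihood ratio m_0/m_1 for the z-test is bounded by exp(−cn) with probability tending to one. -/
open MeasureTheory ProbabilityTheory Filter

open scoped Topology

/-- The coefficient ratio `(3/2)_k / (1/2)_k` equals `2k + 1`. -/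
theorem ascPochhammer_eval_three_halves (k : ℕ) :
    (ascPochhammer ℝ k).eval (3/2) = (2 * k + 1) * (ascPochhammer ℝ k).eval (1/2) := by
  induction k with
  | zero => simp
  | succ k ih =>
    rw [ascPochhammer_succ_eval, ascPochhammer_succ_eval, ih]
    push_cast
    ring

theorem oneF₁_three_halves_one_half_eq_tsum (x : ℝ) :
    oneF₁ (3/2) (1/2) x = ∑' k : ℕ, (2 * k + 1) * (x ^ k / (k.factorial : ℝ)) := by
  refine tsum_congr fun k => ?_
  have h : (ascPochhammer ℝ k).eval (1/2 : ℝ) ≠ 0 := (ascPochhammer_pos k _ (by norm_num)).ne'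
  rw [ascPochhammer_eval_three_halves]
  field_simp

theorem exp_le_oneF₁_three_halves_one_half {x : ℝ} (hx : 0 ≤ x) :
    Real.exp x ≤ oneF₁ (3/2) (1/2) x := by
  rw [oneF₁_three_halves_one_half_eq_tsum, Real.exp_eq_exp_ℝ, NormedSpace.exp_eq_tsum_div]
  have hsum : Summable fun k : ℕ => (2 * (k : ℝ) + 1) * (x ^ k / (k.factorial : ℝ)) := by
    refine Summable.of_nonneg_of_le (fun k => by positivity) (fun k => ?_)
      ((Real.summable_pow_div_factorial (2 * x)).mul_left 2)
    have hk : (k : ℝ) + 1 ≤ 2 ^ k := by exact_mod_cast Nat.lt_two_pow_self (n := k)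
    calc (2 * (k : ℝ) + 1) * (x ^ k / (k.factorial : ℝ))
        ≤ (2 * 2 ^ k) * (x ^ k / (k.factorial : ℝ)) := by gcongr; linarith
      _ = 2 * ((2 * x) ^ k / (k.factorial : ℝ)) := by rw [mul_pow]; ring
  refine (Real.summable_pow_div_factorial x).tsum_le_tsum (fun k => ?_) hsum
  exact le_mul_of_one_le_left (by positivity) (by linarith [k.cast_nonneg (α := ℝ)])

/-- If `c < a² / 2`, then for large `n` the ratio exceeds `exp (cn)` as soon as `|z| ≥ a √n`. -/
theorem eventually_exp_le_Rz {κ a c : ℝ} (hκ : 0 < κ) (ha : 0 ≤ a) (hc : c < a ^ 2 / 2) :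
    ∀ᶠ n : ℕ in atTop, ∀ z : ℝ, a * √n ≤ |z| → Real.exp (c * n) ≤ Rz κ n z := by
  have hlin : Tendsto (fun n : ℕ => 1 + κ * (n : ℝ)) atTop atTop :=
    tendsto_atTop_add_const_left _ _ (tendsto_natCast_atTop_atTop.const_mul_atTop hκ)
  set ε := (a ^ 2 / 2 - c) / κ with hε
  have hε0 : 0 < ε := div_pos (by linarith) hκ
  have hlog := (Real.isLittleO_log_id_atTop.comp_tendsto hlin).bound
    (show 0 < ε / 3 by positivity)
  have hbig := hlin.eventually_ge_atTop (2 * (ε + a ^ 2 / (2 * κ)) / ε)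
  filter_upwards [hlog, hbig] with n hlog hbig z hz
  have hD : 0 < 1 + κ * (n : ℝ) := by positivity
  have hlog' : Real.log (1 + κ * n) ≤ ε / 3 * (1 + κ * n) := by
    simpa [abs_of_pos hD] using (le_abs_self _).trans hlog
  have hbig' : 2 * (ε + a ^ 2 / (2 * κ)) ≤ ε * (1 + κ * n) := by
    rwa [div_le_iff₀ hε0, mul_comm _ ε] at hbig
  have hz2 : a ^ 2 * n ≤ z ^ 2 := by
    have h := pow_le_pow_left₀ (by positivity) hz 2
    rwa [mul_pow, Real.sq_sqrt n.cast_nonneg, sq_abs] at h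
  have hexp : a ^ 2 / 2 * n - a ^ 2 / (2 * κ) ≤ κ * n * z ^ 2 / (2 * (1 + κ * n)) := by
    calc a ^ 2 / 2 * n - a ^ 2 / (2 * κ)
        ≤ κ * n * (a ^ 2 * n) / (2 * (1 + κ * n)) := by
          rw [← sub_nonneg]
          have : κ * n * (a ^ 2 * n) / (2 * (1 + κ * n)) - (a ^ 2 / 2 * n - a ^ 2 / (2 * κ))
              = a ^ 2 / (2 * κ * (1 + κ * n)) := by
            field_simp
            ring
          rw [this]
          positivity
      _ ≤ _ := by gcongr
  have hcn : c * n = a ^ 2 / 2 * n - ε * (κ * n) := by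
    rw [hε]
    field_simp
    ring
  calc Real.exp (c * n)
      ≤ Real.exp (Real.log (1 + κ * n) * (-3 / 2) + κ * n * z ^ 2 / (2 * (1 + κ * n))) := by
        rw [Real.exp_le_exp]
        linarith
    _ = (1 + κ * n) ^ (-(3:ℝ)/2) * Real.exp (κ * n * z ^ 2 / (2 * (1 + κ * n))) := by
        rw [Real.exp_add, Real.rpow_def_of_pos hD]
    _ ≤ Rz κ n z := by
        unfold Rz
        gcongr
        exact exp_le_oneF₁_three_halves_one_half (by positivity)

/-- Chebyshev bound for the mass that `N(m, 1)` puts outside `(-t, t)`, for `t < |m|`. -/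
theorem one_sub_le_gaussianReal_abs_ge {m t : ℝ} (ht : t < |m|) :
    1 - ENNReal.ofReal (1 / (|m| - t) ^ 2) ≤ gaussianReal m 1 {z | t ≤ |z|} := by
  have hmeas : MeasurableSet {z : ℝ | t ≤ |z|} := measurableSet_le measurable_const (by fun_prop)
  have hcheb := meas_ge_le_variance_div_sq (μ := gaussianReal m 1)
    (memLp_id_gaussianReal (μ := m) (v := 1) 2) (sub_pos.2 ht)
  rw [variance_id_gaussianReal] at hcheb
  rw [tsub_le_iff_right, ← prob_add_prob_compl (μ := gaussianReal m 1) hmeas]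
  gcongr
  refine (measure_mono fun z hz => ?_).trans hcheb
  simp only [Set.mem_compl_iff, Set.mem_ofPred_eq, not_le, id, integral_id_gaussianReal] at hz ⊢
  have := abs_sub_abs_le_abs_sub m z
  rw [abs_sub_comm] at this
  linarith

/-- Under the alternative hypothesis (z-statistic with law `N(η√n, 1)`, `η ≠ 0`), for
every `0 < c < η²/2`, the marginal likelihood ratio satisfies
`P(R_n(Z_n) ≥ exp(cn)) → 1`. -/
theorem Rz_alt_exponential_growth (κ : ℝ) (hκ : 0 < κ) (η : ℝ) (hη : η ≠ 0)
    {Ω : Type*} [MeasureSpace Ω] [IsProbabilityMeasure (ℙ : Measure Ω)]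
    (Z : ℕ → Ω → ℝ)
    (hZ : ∀ n, Measure.map (Z n) ℙ = gaussianReal (η * Real.sqrt n) 1) :
    ∀ c : ℝ, 0 < c → c < η^2 / 2 →
      Tendsto (fun n : ℕ => ℙ {w | Real.exp (c * (n : ℝ)) ≤ Rz κ n (Z n w)}) atTop (nhds 1) := by
  intro c hc0 hc
  obtain ⟨a, ha, haη⟩ : ∃ a, √(2 * c) < a ∧ a < |η| :=
    exists_between <| by
      rw [Real.sqrt_lt' (abs_pos.2 hη), sq_abs]
      linarith
  have ha0 : 0 ≤ a := (Real.sqrt_nonneg _).trans ha.le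
  have hca : c < a ^ 2 / 2 := by
    have := (Real.sqrt_lt' ((Real.sqrt_nonneg _).trans_lt ha)).1 ha
    linarith
  have hlim : Tendsto (fun n : ℕ => 1 - ENNReal.ofReal (1 / (|η * √n| - a * √n) ^ 2))
      atTop (𝓝 1) := by
    have h0 : Tendsto (fun n : ℕ => 1 / (|η * √n| - a * √n) ^ 2) atTop (𝓝 0) := by
      have h := (tendsto_one_div_atTop_nhds_zero_nat (𝕜 := ℝ)).const_mul (1 / (|η| - a) ^ 2)
      rw [mul_zero] at h
      refine h.congr fun n => ?_
      rw [abs_mul, abs_of_nonneg (Real.sqrt_nonneg _), ← sub_mul, mul_pow,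
        Real.sq_sqrt n.cast_nonneg, one_div_mul_one_div]
    simpa using ENNReal.Tendsto.sub tendsto_const_nhds (ENNReal.tendsto_ofReal h0)
      (Or.inl ENNReal.one_ne_top)
  refine tendsto_of_tendsto_of_tendsto_of_le_of_le' hlim tendsto_const_nhds ?_
    (Eventually.of_forall fun n => prob_le_one)
  filter_upwards [eventually_exp_le_Rz hκ ha0 hca, eventually_gt_atTop 0] with n hn hn0
  have hZn : AEMeasurable (Z n) ℙ := by
    refine AEMeasurable.of_map_ne_zero ?_
    rw [hZ n]
    exact IsProbabilityMeasure.ne_zero _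
  have hmean : a * √n < |η * √n| := by
    rw [abs_mul, abs_of_nonneg (Real.sqrt_nonneg _)]
    gcongr
  refine (one_sub_le_gaussianReal_abs_ge hmean).trans ?_
  rw [← hZ n, Measure.map_apply_of_aemeasurable hZn
    (measurableSet_le measurable_const (by fun_prop))]
  exact measure_mono fun w hw => hn _ hw
end
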